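/- For every integer k ≥ 2 and every real z with 0 < z < η_k, the series Σ_{n≥1} R_n·z^n converges and its sum equals (r_k(z) − √(Δ_k(z)))/(4z), where r_k(z) = 1 − z + 2·C_k·z^{2k+1}. -/

import Mathlib

open Filter Set

/-- Regular expressions over an alphabet `A` (grammar β := ε | σ | β+β | β·β | β⋆). -/
inductive RegEx (A : Type) : Type where
  | eps : RegEx A
  | char (a : A) : RegEx A
  | plus (l r : RegEx A) : RegEx A
  | cat (l r : RegEx A) : RegEx A
  | star (e : RegEx A) : RegEx A

namespace RegEx

/-- The (tree-)size of an expression: number of symbols / syntax-tree nodes. -/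
def size {A : Type} : RegEx A → ℕ
  | eps => 1
  | char _ => 1
  | plus l r => size l + size r + 1
  | cat l r => size l + size r + 1
  | star e => size e + 1

/-- The number of letter occurrences (alphabetic size). -/
def letters {A : Type} : RegEx A → ℕ
  | eps => 0
  | char _ => 1
  | plus l r => letters l + letters r
  | cat l r => letters l + letters r
  | star e => letters e

/-- `IsUnionOfLetters e l` : `e` is a binary union tree whose leaves are single letters,
read from left to right giving the list `l`. -/
inductive IsUnionOfLetters {A : Type} : RegEx A → List A → Prop where
  | char (a : A) : IsUnionOfLetters (char a) [a]
  | plus {l r : RegEx A} {ll rl : List A} :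
      IsUnionOfLetters l ll → IsUnionOfLetters r rl →
      IsUnionOfLetters (plus l r) (ll ++ rl)

/-- `e` is of the form `(σ_{i₁}+⋯+σ_{i_k})⋆` where `σ_{i₁},…,σ_{i_k}` is a permutation of
the (finite) alphabet `A`. -/
def IsSigmaStar {A : Type} [Fintype A] (e : RegEx A) : Prop :=
  ∃ (f : RegEx A) (l : List A),
    e = star f ∧ IsUnionOfLetters f l ∧ l.Nodup ∧ ∀ a : A, a ∈ l

/-- The absorbing pattern `Σ⋆` does not occur in `e` as an argument of a union. -/
def Avoids {A : Type} [Fintype A] : RegEx A → Prop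
  | eps => True
  | char _ => True
  | plus l r => Avoids l ∧ Avoids r ∧ ¬ IsSigmaStar l ∧ ¬ IsSigmaStar r
  | cat l r => Avoids l ∧ Avoids r
  | star e => Avoids e

end RegEx

/-- Number of expressions in `REna` (over a `k`-letter alphabet) of size `n`. -/
noncomputable def Rcount (k n : ℕ) : ℕ :=
  Nat.card {e : RegEx (Fin k) // RegEx.Avoids e ∧ RegEx.size e = n}

/-- Number of all regular expressions (over a `k`-letter alphabet) of size `n`. -/
noncomputable def Bcount (k n : ℕ) : ℕ :=
  Nat.card {e : RegEx (Fin k) // RegEx.size e = n}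

/-- Total number of letter occurrences over all expressions in `REna` of size `n`. -/
noncomputable def Lcount (k n : ℕ) : ℕ :=
  Nat.card {p : RegEx (Fin k) × ℕ //
    RegEx.Avoids p.1 ∧ RegEx.size p.1 = n ∧ p.2 < RegEx.letters p.1}

/-- `C_k = (2k-2)!/(k-1)!` as a real number. -/
noncomputable def Cc (k : ℕ) : ℝ :=
  ((2 * k - 2).factorial : ℝ) / ((k - 1).factorial : ℝ)

/-- `p_k(z) = 1 − 2z − (7+8k)z²`. -/
noncomputable def Pp (k : ℕ) (z : ℝ) : ℝ := 1 - 2 * z - (7 + 8 * k) * z ^ 2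

/-- `h_k(z) = 1 − z − C_k·z^{2k+1}`. -/
noncomputable def Hh (k : ℕ) (z : ℝ) : ℝ := 1 - z - Cc k * z ^ (2 * k + 1)

/-- `Δ_k(z) = p_k(z) + 4·C_k·z^{2k+1}·h_k(z)`. -/
noncomputable def Dd (k : ℕ) (z : ℝ) : ℝ :=
  Pp k z + 4 * Cc k * z ^ (2 * k + 1) * Hh k z

/-- `g_k(z) = 2 − C_k·z^{2k−1}·(h_k(z) − C_k·z^{2k−1})`. -/
noncomputable def Gg (k : ℕ) (z : ℝ) : ℝ :=
  2 - Cc k * z ^ (2 * k - 1) * (Hh k z - Cc k * z ^ (2 * k - 1))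

/-- `ρ_k = 1/(1+√(8+8k))`, the positive root of `p_k`. -/
noncomputable def rho (k : ℕ) : ℝ := 1 / (1 + Real.sqrt (8 + 8 * k))

/-- `ψ_k(x) = −x·Δ_k′(x)`. -/
noncomputable def psi (k : ℕ) (x : ℝ) : ℝ := -x * deriv (Dd k) x

/-- `η` is a root of `Δ_k` in the interval `(0, 1/√(8+8k))`, and is the unique such root. -/
def IsEta (k : ℕ) (η : ℝ) : Prop :=
  η ∈ Set.Ioo (0 : ℝ) (1 / Real.sqrt (8 + 8 * k)) ∧ Dd k η = 0 ∧
    ∀ x ∈ Set.Ioo (0 : ℝ) (1 / Real.sqrt (8 + 8 * k)), Dd k x = 0 → x = η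

/-- `r_k(z) = 1 − z + 2·C_k·z^{2k+1}`. -/
noncomputable def rr (k : ℕ) (z : ℝ) : ℝ := 1 - z + 2 * Cc k * z ^ (2 * k + 1)

open scoped ENNReal

namespace RegEx

/-- The binary tree of unions of an expression; every other expression is a leaf. -/
def shape {A : Type} : RegEx A → BinaryTree Unit
  | plus l r => .node () (shape l) (shape r)
  | _ => .nil

/-- The letters of an expression, read from left to right. -/
def leaves {A : Type} : RegEx A → List A
  | eps => []
  | char a => [a]
  | plus l r => leaves l ++ leaves r
  | cat l r => leaves l ++ leaves r
  | star e => leaves e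

namespace IsUnionOfLetters

variable {A : Type} {e f : RegEx A} {l : List A}

theorem leaves_eq (h : IsUnionOfLetters e l) : leaves e = l := by
  induction h with
  | char a => rfl
  | plus _ _ h₁ h₂ => simp [leaves, h₁, h₂]

theorem length_eq (h : IsUnionOfLetters e l) : l.length = (shape e).numNodes + 1 := by
  induction h with
  | char a => rfl
  | plus _ _ h₁ h₂ => simp only [List.length_append, shape, BinaryTree.numNodes, h₁, h₂]; omega

theorem size_add_one (h : IsUnionOfLetters e l) : size e + 1 = 2 * l.length := by
  induction h with
  | char a => rfl
  | plus _ _ h₁ h₂ => simp only [List.length_append, size]; omega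

theorem avoids [Fintype A] (h : IsUnionOfLetters e l) : Avoids e := by
  have not_star {f : RegEx A} {m : List A} (hf : IsUnionOfLetters f m) : ¬ IsSigmaStar f := by
    rintro ⟨g, _, rfl, _⟩
    cases hf
  induction h with
  | char a => trivial
  | plus h h' h₁ h₂ => exact ⟨h₁, h₂, not_star h, not_star h'⟩

theorem eq_of_shape_eq (he : IsUnionOfLetters e l) (hf : IsUnionOfLetters f l)
    (h : shape e = shape f) : e = f := by
  induction he generalizing f with
  | char a =>
    generalize hl : [a] = l at hf
    cases hf with
    | char => rw [List.singleton_inj.1 hl]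
    | plus => cases h
  | @plus e₁ e₂ l₁ l₂ he₁ he₂ ih₁ ih₂ =>
    generalize hl : l₁ ++ l₂ = l at hf
    cases hf with
    | char => cases h
    | @plus f₁ f₂ m₁ m₂ hf₁ hf₂ =>
      simp only [shape, BinaryTree.node.injEq, true_and] at h
      have hlen : l₁.length = m₁.length := by
        rw [he₁.length_eq, hf₁.length_eq, h.1]
      obtain ⟨rfl, rfl⟩ := List.append_inj hl hlen
      rw [ih₁ hf₁ h.1, ih₂ hf₂ h.2]

end IsUnionOfLetters

theorem exists_isUnionOfLetters {A : Type} (t : BinaryTree Unit) (l : List A)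
    (hl : l.length = t.numNodes + 1) : ∃ e, IsUnionOfLetters e l ∧ shape e = t := by
  induction t generalizing l with
  | nil =>
    obtain ⟨a, rfl⟩ := List.length_eq_one_iff.1 hl
    exact ⟨char a, .char a, rfl⟩
  | node v t₁ t₂ ih₁ ih₂ =>
    simp only [BinaryTree.numNodes] at hl
    obtain ⟨e₁, h₁, s₁⟩ := ih₁ (l.take (t₁.numNodes + 1)) (by rw [List.length_take]; omega)
    obtain ⟨e₂, h₂, s₂⟩ := ih₂ (l.drop (t₁.numNodes + 1)) (by rw [List.length_drop]; omega)
    refine ⟨plus e₁ e₂, ?_, by simp [shape, s₁, s₂]⟩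
    simpa using h₁.plus h₂

theorem nodup_and_forall_mem_iff_perm {k : ℕ} {l : List (Fin k)} :
    (l.Nodup ∧ ∀ a, a ∈ l) ↔ l.Perm (List.finRange k) := by
  refine ⟨fun h => (List.perm_ext_iff_of_nodup h.1 (List.nodup_finRange k)).2 (by simp [h.2]),
    fun h => ⟨h.nodup_iff.2 (List.nodup_finRange k), fun a => h.mem_iff.2 (List.mem_finRange a)⟩⟩

theorem factorial_mul_catalan (n : ℕ) :
    (((n + 1).factorial * catalan n : ℕ) : ℝ) = Cc (n + 1) := by
  have h : (n + 1).factorial * catalan n * n.factorial = (2 * n).factorial := by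
    have h₁ := succ_mul_catalan_eq_centralBinom n
    have h₂ := Nat.choose_mul_factorial_mul_factorial (show n ≤ 2 * n by omega)
    rw [← Nat.centralBinom_eq_two_mul_choose, ← h₁, show 2 * n - n = n by omega] at h₂
    rw [← h₂, Nat.factorial_succ]
    ring
  rw [Cc, eq_div_iff (by positivity), show 2 * (n + 1) - 2 = 2 * n by omega, Nat.add_sub_cancel]
  exact_mod_cast h

theorem encard_isSigmaStar (n : ℕ) :
    {e : RegEx (Fin (n + 1)) | IsSigmaStar e}.encard =
      ((n + 1).factorial * catalan n : ℕ) := by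
  classical
  set X : Set (RegEx (Fin (n + 1))) := {f | ∃ l, IsUnionOfLetters f l ∧ l.Nodup ∧ ∀ a, a ∈ l}
  have hstar : {e : RegEx (Fin (n + 1)) | IsSigmaStar e} = star '' X := by
    ext e
    constructor
    · rintro ⟨f, l, rfl, h⟩
      exact ⟨f, ⟨l, h⟩, rfl⟩
    · rintro ⟨f, ⟨l, h⟩, rfl⟩
      exact ⟨f, l, rfl, h⟩
  have hinj : Set.InjOn (fun f => (leaves f, shape f)) X := by
    rintro e ⟨l, he, -⟩ f ⟨m, hf, -⟩ h
    simp only [Prod.mk.injEq, he.leaves_eq, hf.leaves_eq] at h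
    obtain ⟨rfl, h⟩ := h
    exact he.eq_of_shape_eq hf h
  have himage : (fun f => (leaves f, shape f)) '' X =
      ((List.finRange (n + 1)).permutations.toFinset ×ˢ BinaryTree.treesOfNumNodesEq n :
        Finset (List (Fin (n + 1)) × BinaryTree Unit)) := by
    ext ⟨l, t⟩
    simp only [Set.mem_image, Prod.mk.injEq, Finset.coe_product, Set.mem_prod, Finset.mem_coe,
      List.mem_toFinset, List.mem_permutations, BinaryTree.mem_treesOfNumNodesEq]
    constructor
    · rintro ⟨f, ⟨m, hf, hm⟩, rfl, rfl⟩
      rw [hf.leaves_eq]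
      have hp := nodup_and_forall_mem_iff_perm.1 hm
      have := hp.length_eq
      rw [hf.length_eq, List.length_finRange] at this
      exact ⟨hp, by omega⟩
    · rintro ⟨hl, rfl⟩
      obtain ⟨e, he, hs⟩ := exists_isUnionOfLetters t l (by simpa using hl.length_eq)
      exact ⟨e, ⟨l, he, nodup_and_forall_mem_iff_perm.2 hl⟩, he.leaves_eq, hs⟩
  rw [hstar, Function.Injective.encard_image (fun _ _ h => star.inj h), ← hinj.encard_image, himage,
    Set.encard_coe_eq_coe_finsetCard, Finset.card_product,
    List.toFinset_card_of_nodup (List.nodup_permutations _ (List.nodup_finRange _)),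
    List.length_permutations, List.length_finRange, BinaryTree.treesOfNumNodesEq_card_eq_catalan]

theorem IsSigmaStar.size_eq {k : ℕ} {e : RegEx (Fin k)} (h : IsSigmaStar e) :
    size e = 2 * k := by
  obtain ⟨f, l, rfl, hf, hl⟩ := h
  rw [size, hf.size_add_one, (nodup_and_forall_mem_iff_perm.1 hl).length_eq, List.length_finRange]

theorem IsSigmaStar.avoids {A : Type} [Fintype A] {e : RegEx A} (h : IsSigmaStar e) :
    Avoids e := by
  obtain ⟨f, l, rfl, hf, -⟩ := h
  exact hf.avoids

theorem finite_size_eq (A : Type) [Finite A] (n : ℕ) : {e : RegEx A | size e = n}.Finite := by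
  suffices h : {e : RegEx A | size e ≤ n}.Finite from h.subset fun e he => le_of_eq he
  induction n with
  | zero =>
    refine Set.finite_empty.subset fun e he => ?_
    cases e <;> simp [size] at he
  | succ n ih =>
    refine ((((Set.finite_singleton eps).union (Set.finite_range char)).union
      (((ih.prod ih).image fun p => plus p.1 p.2).union
        ((ih.prod ih).image fun p => cat p.1 p.2))).union (ih.image star)).subset ?_
    intro e he
    cases e with
    | eps => simp
    | char a => simp
    | plus l r =>
      refine .inl (.inr (.inl ⟨(l, r), ⟨?_, ?_⟩, rfl⟩)) <;>
        simp only [Set.mem_ofPred_eq, size] at he ⊢ <;> omega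
    | cat l r =>
      refine .inl (.inr (.inr ⟨(l, r), ⟨?_, ?_⟩, rfl⟩)) <;>
        simp only [Set.mem_ofPred_eq, size] at he ⊢ <;> omega
    | star e =>
      refine .inr ⟨e, ?_, rfl⟩
      simp only [Set.mem_ofPred_eq, size] at he ⊢; omega

/-- An expression is its root symbol together with the arguments of that symbol. -/
def equivSum (A : Type) :
    RegEx A ≃ (Unit ⊕ A) ⊕ ((RegEx A × RegEx A) ⊕ (RegEx A × RegEx A)) ⊕ RegEx A where
  toFun
    | eps => .inl (.inl ())
    | char a => .inl (.inr a)
    | plus l r => .inr (.inl (.inl (l, r)))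
    | cat l r => .inr (.inl (.inr (l, r)))
    | star e => .inr (.inr e)
  invFun
    | .inl (.inl _) => eps
    | .inl (.inr a) => char a
    | .inr (.inl (.inl p)) => plus p.1 p.2
    | .inr (.inl (.inr p)) => cat p.1 p.2
    | .inr (.inr e) => star e
  left_inv e := by cases e <;> rfl
  right_inv s := by rcases s with (_ | _) | (_ | _) | _ <;> rfl

theorem tsum_eq {A : Type} (f : RegEx A → ℝ≥0∞) :
    ∑' e, f e = f eps + ∑' a, f (char a) +
      (∑' l, ∑' r, f (plus l r) + ∑' l, ∑' r, f (cat l r) + ∑' e, f (star e)) := by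
  rw [← (equivSum A).symm.tsum_eq]
  repeat rw [Summable.tsum_sum ENNReal.summable ENNReal.summable]
  rw [ENNReal.tsum_prod', ENNReal.tsum_prod']
  simp [equivSum]

open Classical in
/-- The total weight of the expressions in `REna`, an expression of size `n` weighing `f n`. -/
noncomputable def weight (k : ℕ) (f : ℕ → ℝ≥0∞) : ℝ≥0∞ :=
  ∑' e : RegEx (Fin k), if Avoids e then f (size e) else 0

open Classical in
/-- The total weight of the expressions in `REna` other than `Σ⋆`. -/
noncomputable def argWeight (k : ℕ) (f : ℕ → ℝ≥0∞) : ℝ≥0∞ :=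
  ∑' e : RegEx (Fin k), if Avoids e ∧ ¬ IsSigmaStar e then f (size e) else 0

theorem weight_eq_tsum (k : ℕ) (f : ℕ → ℝ≥0∞) :
    weight k f = ∑' n, (Rcount k n : ℝ≥0∞) * f n := by
  classical
  have h (e : RegEx (Fin k)) : (if Avoids e then f (size e) else 0) =
      ∑' n, if Avoids e ∧ size e = n then f n else 0 := by
    rw [tsum_eq_single (size e) (fun n hn => if_neg fun h => hn h.2.symm)]
    simp
  simp_rw [weight, h]
  rw [ENNReal.tsum_comm]
  refine tsum_congr fun n => ?_
  set s : Set (RegEx (Fin k)) := {e | Avoids e ∧ size e = n}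
  have hs : s.Finite := (finite_size_eq (Fin k) n).subset fun e he => he.2
  have hcard : s.encard = (Rcount k n : ℕ∞) := by
    rw [← hs.cast_ncard_eq]
    rfl
  have := tsum_subtype s fun _ => f n
  rw [ENNReal.tsum_set_const, hcard] at this
  simpa [Set.indicator_apply, s] using this.symm

theorem weight_eq_argWeight_add (n : ℕ) (f : ℕ → ℝ≥0∞) :
    weight (n + 1) f = argWeight (n + 1) f +
      ((n + 1).factorial * catalan n : ℕ) * f (2 * (n + 1)) := by
  classical
  have := tsum_subtype {e : RegEx (Fin (n + 1)) | IsSigmaStar e} fun _ => f (2 * (n + 1))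
  rw [ENNReal.tsum_set_const, encard_isSigmaStar, ENat.toENNReal_coe] at this
  rw [this, weight, argWeight, ← ENNReal.tsum_add]
  refine tsum_congr fun e => ?_
  by_cases h : IsSigmaStar e
  · simp [h, h.avoids, h.size_eq]
  · simp [h]

open Classical in
theorem weight_eq (k : ℕ) (f : ℕ → ℝ≥0∞) :
    weight k f = (k + 1) * f 1 +
      (∑' (l : RegEx (Fin k)) (r : RegEx (Fin k)),
          (if (Avoids l ∧ ¬ IsSigmaStar l) ∧ Avoids r ∧ ¬ IsSigmaStar r
            then f (size l + size r + 1) else 0) +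
        ∑' (l : RegEx (Fin k)) (r : RegEx (Fin k)),
          (if Avoids l ∧ Avoids r then f (size l + size r + 1) else 0) +
        ∑' e : RegEx (Fin k), if Avoids e then f (size e + 1) else 0) := by
  rw [weight, tsum_eq]
  congr 1
  · have (a : Fin k) : (if Avoids (char a) then f (size (char a)) else 0) = f 1 := if_pos trivial
    simp_rw [this]
    rw [if_pos (show Avoids eps from trivial), tsum_fintype, Finset.sum_const, Finset.card_univ, Fintype.card_fin,
      nsmul_eq_mul, add_comm, add_mul, one_mul]
    rfl
  · refine congrArg₂ (· + ·) (congrArg₂ (· + ·) ?_ ?_) ?_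
    · refine tsum_congr fun l => tsum_congr fun r => if_congr ?_ rfl rfl
      simp only [Avoids]
      tauto
    · exact tsum_congr fun l => tsum_congr fun r => if_congr Iff.rfl rfl rfl
    · exact tsum_congr fun e => if_congr Iff.rfl rfl rfl

/-- The functional equation of the weight, as an inequality that also covers weights truncated
at some size. -/
theorem weight_le {k : ℕ} {f : ℕ → ℝ≥0∞} {x : ℝ≥0∞} (h₁ : f 1 ≤ x)
    (hs : ∀ m, f (m + 1) ≤ x * f m) (hm : ∀ m n, f (m + n + 1) ≤ x * (f m * f n)) :
    weight k f ≤ (k + 1) * x +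
      (x * argWeight k f ^ 2 + x * weight k f ^ 2 + x * weight k f) := by
  classical
  conv_lhs => rw [weight_eq]
  simp_rw [sq, weight, argWeight, ← ENNReal.tsum_mul_right, ← ENNReal.tsum_mul_left]
  gcongr ?_ + (?_ + ?_ + ?_)
  · gcongr
  · refine ENNReal.tsum_le_tsum fun l => ENNReal.tsum_le_tsum fun r => ?_
    rw [ite_zero_mul_ite_zero, mul_ite_zero]
    split_ifs
    exacts [hm _ _, le_rfl]
  · refine ENNReal.tsum_le_tsum fun l => ENNReal.tsum_le_tsum fun r => ?_
    rw [ite_zero_mul_ite_zero, mul_ite_zero]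
    split_ifs
    exacts [hm _ _, le_rfl]
  · refine ENNReal.tsum_le_tsum fun e => ?_
    rw [mul_ite_zero]
    split_ifs
    exacts [hs _, le_rfl]

/-- The functional equation of the generating function. -/
theorem weight_pow (k : ℕ) (x : ℝ≥0∞) :
    weight k (x ^ ·) = (k + 1) * x + (x * argWeight k (x ^ ·) ^ 2 + x * weight k (x ^ ·) ^ 2 +
      x * weight k (x ^ ·)) := by
  classical
  conv_lhs => rw [weight_eq]
  have hm (m n : ℕ) : x ^ (m + n + 1) = x * (x ^ m * x ^ n) := by ring
  simp_rw [sq, weight, argWeight, ← ENNReal.tsum_mul_right, ← ENNReal.tsum_mul_left, pow_one,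
    ite_zero_mul_ite_zero, mul_ite_zero, hm, pow_succ']

end RegEx
namespace RegEx

theorem weight_ofReal {k : ℕ} {φ : ℕ → ℝ} {t : ℝ} (hφ : ∀ n, 0 ≤ φ n)
    (h : HasSum (fun n => (Rcount k n : ℝ) * φ n) t) :
    weight k (fun n => ENNReal.ofReal (φ n)) = ENNReal.ofReal t := by
  rw [weight_eq_tsum, ← h.tsum_eq,
    ENNReal.ofReal_tsum_of_nonneg (fun n => mul_nonneg (Nat.cast_nonneg _) (hφ n)) h.summable]
  refine tsum_congr fun n => ?_
  rw [ENNReal.ofReal_mul (Nat.cast_nonneg _), ENNReal.ofReal_natCast]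

theorem Cc_nonneg (k : ℕ) : 0 ≤ Cc k := by
  unfold Cc
  positivity

theorem argWeight_ofReal {k : ℕ} (hk : k ≠ 0) {φ : ℕ → ℝ} {t : ℝ} (hφ : ∀ n, 0 ≤ φ n)
    (h : HasSum (fun n => (Rcount k n : ℝ) * φ n) t) :
    0 ≤ t - Cc k * φ (2 * k) ∧
      argWeight k (fun n => ENNReal.ofReal (φ n)) = ENNReal.ofReal (t - Cc k * φ (2 * k)) := by
  obtain ⟨n, rfl⟩ := Nat.exists_eq_succ_of_ne_zero hk
  have ht : 0 ≤ t := h.nonneg fun n => mul_nonneg (Nat.cast_nonneg _) (hφ n)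
  have hS : 0 ≤ Cc (n + 1) * φ (2 * (n + 1)) := mul_nonneg (Cc_nonneg _) (hφ _)
  have hw := weight_eq_argWeight_add n fun n => ENNReal.ofReal (φ n)
  rw [weight_ofReal hφ h, ← ENNReal.ofReal_natCast, ← ENNReal.ofReal_mul (Nat.cast_nonneg _),
    factorial_mul_catalan] at hw
  refine ⟨sub_nonneg.2 ((ENNReal.ofReal_le_ofReal_iff ht).1 (hw ▸ le_add_self)), ?_⟩
  rw [ENNReal.ofReal_sub _ hS]
  exact ENNReal.eq_sub_of_add_eq ENNReal.ofReal_ne_top hw.symm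

theorem ofReal_functional {k : ℕ} {x s t : ℝ} (hx : 0 ≤ x) (hs : 0 ≤ s) (ht : 0 ≤ t) :
    (k + 1) * ENNReal.ofReal x + (ENNReal.ofReal x * ENNReal.ofReal s ^ 2 +
      ENNReal.ofReal x * ENNReal.ofReal t ^ 2 + ENNReal.ofReal x * ENNReal.ofReal t) =
    ENNReal.ofReal ((k + 1) * x + (x * s ^ 2 + x * t ^ 2 + x * t)) := by
  rw [ENNReal.ofReal_add (by positivity) (by positivity),
    ENNReal.ofReal_add (by positivity) (by positivity),
    ENNReal.ofReal_add (by positivity) (by positivity), ENNReal.ofReal_mul (by positivity),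
    ENNReal.ofReal_mul hx, ENNReal.ofReal_mul hx, ENNReal.ofReal_mul hx, ENNReal.ofReal_pow hs,
    ENNReal.ofReal_pow ht, ENNReal.ofReal_add (by positivity) zero_le_one, ENNReal.ofReal_natCast,
    ENNReal.ofReal_one]

theorem sum_range_le {k N : ℕ} (hk : k ≠ 0) (hN : 2 * k < N) {x : ℝ} (hx : 0 ≤ x) {t : ℝ}
    (ht : ∑ n ∈ Finset.range N, (Rcount k n : ℝ) * x ^ n = t) :
    t ≤ (k + 1) * x + (x * (t - Cc k * x ^ (2 * k)) ^ 2 + x * t ^ 2 + x * t) := by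
  set φ : ℕ → ℝ := fun n => if n < N then x ^ n else 0 with hφ_def
  have hφ (n : ℕ) : 0 ≤ φ n := by
    simp only [hφ_def]
    split_ifs <;> positivity
  have hsum : HasSum (fun n => (Rcount k n : ℝ) * φ n) t := by
    have : ∑ n ∈ Finset.range N, (Rcount k n : ℝ) * φ n = t := by
      rw [← ht]
      exact Finset.sum_congr rfl fun n hn => by simp [hφ_def, Finset.mem_range.1 hn]
    rw [← this]
    exact hasSum_sum_of_ne_finset_zero fun n hn => by simp_all
  have ht₀ : 0 ≤ t := hsum.nonneg fun n => mul_nonneg (Nat.cast_nonneg _) (hφ n)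
  obtain ⟨hs₀, hs⟩ := argWeight_ofReal hk hφ hsum
  have hmul {a b : ℝ} (ha : 0 ≤ a) (h : b ≤ x * a) :
      ENNReal.ofReal b ≤ ENNReal.ofReal x * ENNReal.ofReal a := by
    rw [← ENNReal.ofReal_mul hx]
    exact ENNReal.ofReal_le_ofReal h
  have h := weight_le (k := k) (f := fun n => ENNReal.ofReal (φ n)) (x := ENNReal.ofReal x)
    (ENNReal.ofReal_le_ofReal (by simp only [hφ_def]; split_ifs <;> simp [hx]))
    (fun m => hmul (hφ m) (by
      simp only [hφ_def]
      split_ifs <;> first | omega | simp [pow_succ'] | positivity))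
    (fun m n => by
      rw [← ENNReal.ofReal_mul (hφ m)]
      refine hmul (mul_nonneg (hφ m) (hφ n)) ?_
      simp only [hφ_def]
      split_ifs <;> first | omega | simp [pow_succ', pow_add] | positivity)
  rw [weight_ofReal hφ hsum, hs, ofReal_functional hx hs₀ ht₀,
    ENNReal.ofReal_le_ofReal_iff (by positivity)] at h
  simpa [hφ_def, hN] using h

theorem eq_of_hasSum {k : ℕ} (hk : k ≠ 0) {x : ℝ} (hx : 0 ≤ x) {t : ℝ}
    (ht : HasSum (fun n => (Rcount k n : ℝ) * x ^ n) t) :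
    t = (k + 1) * x + (x * (t - Cc k * x ^ (2 * k)) ^ 2 + x * t ^ 2 + x * t) := by
  have hφ (n : ℕ) : 0 ≤ x ^ n := pow_nonneg hx n
  have ht₀ : 0 ≤ t := ht.nonneg fun n => mul_nonneg (Nat.cast_nonneg _) (hφ n)
  obtain ⟨hs₀, hs⟩ := argWeight_ofReal hk hφ ht
  have h := weight_pow k (ENNReal.ofReal x)
  simp_rw [← ENNReal.ofReal_pow hx] at h
  rwa [weight_ofReal hφ ht, hs, ofReal_functional hx hs₀ ht₀,
    ENNReal.ofReal_eq_ofReal_iff ht₀ (by positivity)] at h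

/-- The discriminant identity behind the closed form of the generating function. -/
theorem sq_sub_Dd (k : ℕ) (x t : ℝ) :
    (rr k x - 4 * x * t) ^ 2 - Dd k x =
      8 * x * ((k + 1) * x + (x * (t - Cc k * x ^ (2 * k)) ^ 2 + x * t ^ 2 + x * t) - t) := by
  simp only [rr, Dd, Pp, Hh]
  ring

end RegEx

theorem IsEta.Dd_pos {k : ℕ} {η : ℝ} (hη : IsEta k η) {x : ℝ} (hx : x ∈ Set.Ico 0 η) :
    0 < Dd k x := by
  by_contra! h
  have hcont : ContinuousOn (Dd k) (Set.Icc 0 x) := by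
    unfold Dd Pp Hh
    fun_prop
  have h0 : Dd k 0 = 1 := by simp [Dd, Pp]
  obtain ⟨y, hy, hy0⟩ := intermediate_value_Icc' hx.1 hcont (show (0 : ℝ) ∈ Set.Icc _ _ from
    ⟨h, by simp [h0]⟩)
  have hyne : y ≠ 0 := by
    rintro rfl
    simp [h0] at hy0
  have hyη : y < η := hy.2.trans_lt hx.2
  exact hyη.ne (hη.2.2 y ⟨hy.1.lt_of_ne' hyne, hyη.trans hη.1.2⟩ hy0)

/-- The truncated sum stays on the lower branch of its quadratic inequality, because it starts
there at `0` and the two branches do not meet before `η`. -/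
theorem IsEta.sqrt_Dd_le {k : ℕ} (hk : k ≠ 0) {η : ℝ} (hη : IsEta k η) {N : ℕ} (hN : 2 * k < N)
    {z : ℝ} (hz : z ∈ Set.Ioo 0 η) :
    Real.sqrt (Dd k z) ≤
      rr k z - 4 * z * ∑ n ∈ Finset.range N, (Rcount k n : ℝ) * z ^ n := by
  set g : ℝ → ℝ := fun x => rr k x - 4 * x * ∑ n ∈ Finset.range N, (Rcount k n : ℝ) * x ^ n
  have hg {x : ℝ} (hx : 0 ≤ x) : Dd k x ≤ g x ^ 2 := by
    rw [← sub_nonneg, RegEx.sq_sub_Dd]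
    exact mul_nonneg (by positivity) (sub_nonneg.2 (RegEx.sum_range_le hk hN hx rfl))
  have hcont : ContinuousOn g (Set.Icc 0 z) := by
    simp only [g, rr]
    fun_prop
  have hg0 : g 0 = 1 := by simp [g, rr]
  refine (Real.sqrt_le_sqrt (hg hz.1.le)).trans_eq (Real.sqrt_sq ?_)
  by_contra! h
  obtain ⟨y, hy, hy0⟩ := intermediate_value_Icc' hz.1.le hcont (show (0 : ℝ) ∈ Set.Icc _ _ from
    ⟨h.le, by simp [hg0]⟩)
  have := (hη.Dd_pos ⟨hy.1, hy.2.trans_lt hz.2⟩).trans_le (hg hy.1)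
  simp [hy0] at this

/-- For every integer `k ≥ 2` and every real `z` with `0 < z < η_k`,
the series `Σ_{n≥1} R_n·z^n` converges and its sum equals `(r_k(z) − √(Δ_k(z)))/(4z)`
(note `R_0 = 0`). -/
theorem statement12 (k : ℕ) (hk : 2 ≤ k) (η : ℝ) (hη : IsEta k η)
    (z : ℝ) (hz : z ∈ Set.Ioo 0 η) :
    HasSum (fun n : ℕ => (Rcount k n : ℝ) * z ^ n)
      ((rr k z - Real.sqrt (Dd k z)) / (4 * z)) := by
  have hk₀ : k ≠ 0 := by omega
  have hz₀ : 0 < z := hz.1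
  have hterm (n : ℕ) : 0 ≤ (Rcount k n : ℝ) * z ^ n := by positivity
  have hle (N : ℕ) : ∑ n ∈ Finset.range N, (Rcount k n : ℝ) * z ^ n ≤
      (rr k z - Real.sqrt (Dd k z)) / (4 * z) := by
    have h := hη.sqrt_Dd_le hk₀ (N := N + (2 * k + 1)) (by omega) hz
    refine (Finset.sum_le_sum_of_subset_of_nonneg
      (Finset.range_subset_range.2 (Nat.le_add_right N (2 * k + 1))) fun n _ _ => hterm n).trans ?_
    rw [le_div_iff₀ (by positivity)]
    linarith
  have hsum := (summable_of_sum_range_le hterm hle).hasSum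
  have hbound := Real.tsum_le_of_sum_range_le hterm hle
  set t := ∑' n, (Rcount k n : ℝ) * z ^ n
  have hsq : (rr k z - 4 * z * t) ^ 2 = Dd k z := by
    rw [← sub_eq_zero, RegEx.sq_sub_Dd, ← RegEx.eq_of_hasSum hk₀ hz₀.le hsum, sub_self, mul_zero]
  rw [le_div_iff₀ (by positivity)] at hbound
  have hroot : Real.sqrt (Dd k z) = rr k z - 4 * z * t := by
    rw [← hsq, Real.sqrt_sq]
    linarith [Real.sqrt_nonneg (Dd k z)]
  convert hsum using 1
  rw [hroot]
  field_simp
  ring
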